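/- In the empirical ODE setting, assume additionally that there is M > 0 with |f_ℓ(x, t; θ)| ≤ M for all components ℓ = 1, …, d and all x ∈ ℝ^d, t ∈ [0,T], θ ∈ ℝ^ℓ, and set X := sup_{j, t∈[0,T]} ‖X_j(t)‖ and X̂ := sup_{j, t∈[0,T]} ‖X̂_j(t)‖ (both finite). Then the function W is continuous on [0,T], and for every partition 0 = t₀ < t₁ < ⋯ < t_n = T with mesh Δt := max_i (t_{i+1} − t_i): |Σ_{i=0}^{n−1} W(t_i)(t_{i+1} − t_i) − ∫₀^T W(t) dt| ≤ 4 √d · M (X + X̂) T · Δt. (This substantiates the claim, made after Definition 2.3 and in the proof of Theorem 2.1, that for ODE models the error of approximating the local time-decoupled squared Wasserstein-2 distance by its Riemann sum is O(max_i (t_{i+1} − t_i)).) -/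

import Mathlib

open MeasureTheory Set
open scoped Classical ENNReal NNReal

/-- The squared Wasserstein-2 distance between two Borel measures. -/
noncomputable def W2sq {E : Type*} [MeasurableSpace E] [NormedAddCommGroup E]
    (μ ν : Measure E) : ℝ :=
  sInf {r : ℝ | ∃ π : Measure (E × E), IsProbabilityMeasure π ∧
    π.map Prod.fst = μ ∧ π.map Prod.snd = ν ∧ r = ∫ p, ‖p.1 - p.2‖ ^ 2 ∂π}

/-- The empirical conditional measure `ν_j(t) = |S_j|⁻¹ ∑_{i ∈ S_j} δ_{X_i(t)}`,
where `S_j = {i : ‖x₀ i - x₀ j‖ ≤ δ}`. -/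
noncomputable def empMeas {d N : ℕ} (x₀ : Fin N → EuclideanSpace ℝ (Fin d))
    (X : Fin N → ℝ → EuclideanSpace ℝ (Fin d)) (δ : ℝ) (j : Fin N) (t : ℝ) :
    Measure (EuclideanSpace ℝ (Fin d)) :=
  (((Finset.univ.filter fun i => ‖x₀ i - x₀ j‖ ≤ δ).card : ℝ≥0∞))⁻¹ •
    ∑ i ∈ Finset.univ.filter fun i => ‖x₀ i - x₀ j‖ ≤ δ, Measure.dirac (X i t)

/-- The empirical local squared Wasserstein-2 distance
`W(t) = N⁻¹ ∑_j W₂²(ν_j(t), ν̂_j(t))`. -/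
noncomputable def empW {d N : ℕ} (x₀ : Fin N → EuclideanSpace ℝ (Fin d))
    (X Xhat : Fin N → ℝ → EuclideanSpace ℝ (Fin d)) (δ : ℝ) (t : ℝ) : ℝ :=
  (N : ℝ)⁻¹ * ∑ j : Fin N, W2sq (empMeas x₀ X δ j t) (empMeas x₀ Xhat δ j t)

/-- The uniform measure on a finite family of points, counted with multiplicity. -/
noncomputable def uniformOnPoints {ι E : Type*} [MeasurableSpace E] (S : Finset ι) (a : ι → E) :
    Measure E :=
  (S.card : ℝ≥0∞)⁻¹ • ∑ i ∈ S, Measure.dirac (a i)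

section Couplings

variable {ι E : Type*}

/-- The share of the `i`-th point in the mass which the family `a` puts at `x`. -/
noncomputable def pointShare (S : Finset ι) (a : ι → E) (i : ι) (x : E) : ℝ :=
  if x = a i then ((S.filter fun l => a l = x).card : ℝ)⁻¹ else 0

lemma pointShare_nonneg (S : Finset ι) (a : ι → E) (i : ι) (x : E) : 0 ≤ pointShare S a i x := by
  unfold pointShare; split_ifs <;> positivity

lemma pointShare_le_one (S : Finset ι) (a : ι → E) (i : ι) (x : E) : pointShare S a i x ≤ 1 := by
  unfold pointShare; split_ifs
  · exact Nat.cast_inv_le_one _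
  · exact zero_le_one

lemma sum_pointShare (S : Finset ι) (a : ι → E) {x : E} (hx : x ∈ S.image a) :
    ∑ i ∈ S, pointShare S a i x = 1 := by
  obtain ⟨l, hl, rfl⟩ := Finset.mem_image.1 hx
  have h : ((S.filter fun i => a i = a l).card : ℝ) ≠ 0 := by
    simpa using ⟨l, hl, rfl⟩
  simp only [pointShare, eq_comm (a := a l)]
  rw [← Finset.sum_filter, Finset.sum_const, nsmul_eq_mul, mul_inv_cancel₀ h]

variable [MeasurableSpace E]

lemma isProbabilityMeasure_uniformOnPoints {S : Finset ι} (hS : S.Nonempty) (a : ι → E) :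
    IsProbabilityMeasure (uniformOnPoints S a) := by
  constructor
  have h : (S.card : ℝ≥0∞) ≠ 0 := by simpa using hS.ne_empty
  simp [uniformOnPoints, ENNReal.inv_mul_cancel h]

lemma ae_mem_image_uniformOnPoints [MeasurableSingletonClass E] (S : Finset ι) (a : ι → E) :
    ∀ᵐ x ∂(uniformOnPoints S a), x ∈ S.image a := by
  rw [ae_iff]
  have hm : MeasurableSet {x | ¬ x ∈ S.image a} := (S.image a).measurableSet.compl
  rw [uniformOnPoints, Measure.smul_apply, Measure.finsetSum_apply, Finset.sum_eq_zero, smul_zero]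
  intro i hi
  rw [Measure.dirac_apply' _ hm, indicator_of_notMem]
  simpa using ⟨i, hi, rfl⟩

lemma measurable_pointShare [MeasurableSingletonClass E] (S : Finset ι) (a : ι → E) (i : ι) :
    Measurable (pointShare S a i) := by
  have : pointShare S a i =
      ({a i} : Set E).indicator fun _ => ((S.filter fun l => a l = a i).card : ℝ)⁻¹ := by
    ext x
    by_cases h : x = a i <;> simp [pointShare, h]
  rw [this]
  exact measurable_const.indicator (measurableSet_singleton _)

lemma integral_pointShare [MeasurableSingletonClass E] {S : Finset ι} (a : ι → E) {i : ι}
    (hi : i ∈ S) :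
    ∫ x, pointShare S a i x ∂(uniformOnPoints S a) = (S.card : ℝ)⁻¹ := by
  have h : ((S.filter fun l => a l = a i).card : ℝ) ≠ 0 := by
    simpa using ⟨i, hi, rfl⟩
  rw [uniformOnPoints, integral_smul_measure, integral_finsetSum_measure]
  · simp only [integral_dirac]
    have : ∑ l ∈ S, pointShare S a i (a l) = 1 := by
      have : ∀ l ∈ S, pointShare S a i (a l) =
          if a l = a i then ((S.filter fun l => a l = a i).card : ℝ)⁻¹ else 0 := by
        intro l _
        unfold pointShare
        split_ifs with h' <;> simp [h']
      rw [Finset.sum_congr rfl this, ← Finset.sum_filter, Finset.sum_const, nsmul_eq_mul,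
        mul_inv_cancel₀ h]
    simp [this]
  · intro l _
    exact Integrable.of_bound (measurable_pointShare S a i).aestronglyMeasurable 1
      (.of_forall fun x => by
        rw [Real.norm_of_nonneg (pointShare_nonneg ..)]; exact pointShare_le_one ..)

/-- Every coupling of two uniform measures on families indexed by `S` comes from a transport plan
on the index set. -/
lemma exists_transportPlan_of_coupling [NormedAddCommGroup E] [MeasurableSingletonClass E]
    {S : Finset ι} (a b : ι → E) (π : Measure (E × E)) [IsProbabilityMeasure π]
    (h₁ : π.map Prod.fst = uniformOnPoints S a) (h₂ : π.map Prod.snd = uniformOnPoints S b) :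
    ∃ p : ι → ι → ℝ, (∀ i k, 0 ≤ p i k) ∧ (∀ i ∈ S, ∑ k ∈ S, p i k = (S.card : ℝ)⁻¹) ∧
      (∀ k ∈ S, ∑ i ∈ S, p i k = (S.card : ℝ)⁻¹) ∧
      ∫ z, ‖z.1 - z.2‖ ^ 2 ∂π = ∑ i ∈ S, ∑ k ∈ S, p i k * ‖a i - b k‖ ^ 2 := by
  set q : ι → ι → E × E → ℝ := fun i k z => pointShare S a i z.1 * pointShare S b k z.2 with hq
  have hma : ∀ i, Measurable fun z : E × E => pointShare S a i z.1 := fun i =>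
    (measurable_pointShare S a i).comp measurable_fst
  have hmb : ∀ k, Measurable fun z : E × E => pointShare S b k z.2 := fun k =>
    (measurable_pointShare S b k).comp measurable_snd
  have hq0 : ∀ i k z, 0 ≤ q i k z := fun i k z =>
    mul_nonneg (pointShare_nonneg ..) (pointShare_nonneg ..)
  have hqi : ∀ i k, Integrable (q i k) π := fun i k =>
    Integrable.of_bound ((hma i).mul (hmb k)).aestronglyMeasurable 1 (.of_forall fun z => by
      rw [Real.norm_of_nonneg (hq0 i k z)]
      exact mul_le_one₀ (pointShare_le_one ..) (pointShare_nonneg ..) (pointShare_le_one ..))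
  have hae₁ : ∀ᵐ z ∂π, z.1 ∈ S.image a :=
    ae_of_ae_map measurable_fst.aemeasurable (h₁ ▸ ae_mem_image_uniformOnPoints S a)
  have hae₂ : ∀ᵐ z ∂π, z.2 ∈ S.image b :=
    ae_of_ae_map measurable_snd.aemeasurable (h₂ ▸ ae_mem_image_uniformOnPoints S b)
  refine ⟨fun i k => ∫ z, q i k z ∂π, fun i k => integral_nonneg (hq0 i k), fun i hi => ?_,
    fun k hk => ?_, ?_⟩
  · rw [← integral_finsetSum _ fun k _ => hqi i k, ← integral_pointShare a hi, ← h₁,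
      integral_map measurable_fst.aemeasurable (measurable_pointShare S a i).aestronglyMeasurable]
    refine integral_congr_ae ?_
    filter_upwards [hae₂] with z hz
    rw [hq, ← Finset.mul_sum, sum_pointShare S b hz, mul_one]
  · rw [← integral_finsetSum _ fun i _ => hqi i k, ← integral_pointShare b hk, ← h₂,
      integral_map measurable_snd.aemeasurable (measurable_pointShare S b k).aestronglyMeasurable]
    refine integral_congr_ae ?_
    filter_upwards [hae₁] with z hz
    rw [hq, ← Finset.sum_mul, sum_pointShare S a hz, one_mul]
  · simp only [← integral_mul_const]
    rw [← Finset.sum_congr rfl fun i _ =>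
        integral_finsetSum S fun k _ => (hqi i k).mul_const (‖a i - b k‖ ^ 2),
      ← integral_finsetSum _ fun i _ =>
        integrable_finsetSum S fun k _ => (hqi i k).mul_const (‖a i - b k‖ ^ 2)]
    refine integral_congr_ae ?_
    filter_upwards [hae₁, hae₂] with z hz₁ hz₂
    have : ∀ i k, q i k z * ‖a i - b k‖ ^ 2 = q i k z * ‖z.1 - z.2‖ ^ 2 := by
      intro i k
      by_cases h : z.1 = a i
      · by_cases h' : z.2 = b k
        · rw [h, h']
        · simp [hq, pointShare, h']
      · simp [hq, pointShare, h]
    simp only [this, ← Finset.sum_mul]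
    simp only [hq, ← Finset.mul_sum, sum_pointShare S b hz₂, mul_one, sum_pointShare S a hz₁,
      one_mul]

lemma W2sq_le_of_coupling [NormedAddCommGroup E] {μ ν : Measure E} (π : Measure (E × E))
    [IsProbabilityMeasure π] (h₁ : π.map Prod.fst = μ) (h₂ : π.map Prod.snd = ν) :
    W2sq μ ν ≤ ∫ z, ‖z.1 - z.2‖ ^ 2 ∂π := by
  refine csInf_le ⟨0, ?_⟩ ⟨π, inferInstance, h₁, h₂, rfl⟩
  rintro r ⟨π', -, -, -, rfl⟩
  exact integral_nonneg fun _ => by positivity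

/-- A transport plan on the index set bounds the squared Wasserstein distance of the uniform
measures from above by its cost. -/
lemma W2sq_uniformOnPoints_le [NormedAddCommGroup E] [MeasurableSingletonClass E]
    {S : Finset ι} (hS : S.Nonempty) (a b : ι → E) {p : ι → ι → ℝ} (hp : ∀ i k, 0 ≤ p i k)
    (hp₁ : ∀ i ∈ S, ∑ k ∈ S, p i k = (S.card : ℝ)⁻¹)
    (hp₂ : ∀ k ∈ S, ∑ i ∈ S, p i k = (S.card : ℝ)⁻¹) :
    W2sq (uniformOnPoints S a) (uniformOnPoints S b) ≤
      ∑ i ∈ S, ∑ k ∈ S, p i k * ‖a i - b k‖ ^ 2 := by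
  set π : Measure (E × E) :=
    ∑ i ∈ S, ∑ k ∈ S, ENNReal.ofReal (p i k) • Measure.dirac (a i, b k) with hπ
  have hcard : ENNReal.ofReal (S.card : ℝ)⁻¹ = (S.card : ℝ≥0∞)⁻¹ := by
    rw [ENNReal.ofReal_inv_of_pos (by exact_mod_cast hS.card_pos), ENNReal.ofReal_natCast]
  have h₁ : π.map Prod.fst = uniformOnPoints S a := by
    ext s hs
    rw [Measure.map_apply measurable_fst hs]
    simp only [hπ, uniformOnPoints, Measure.finsetSum_apply, Measure.smul_apply, smul_eq_mul,
      Measure.dirac_apply' _ hs, Measure.dirac_apply' _ (measurable_fst hs), Finset.mul_sum]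
    refine Finset.sum_congr rfl fun i hi => ?_
    rw [← hcard, ← hp₁ i hi, ENNReal.ofReal_sum_of_nonneg fun k _ => hp i k, Finset.sum_mul]
    rfl
  have h₂ : π.map Prod.snd = uniformOnPoints S b := by
    ext s hs
    rw [Measure.map_apply measurable_snd hs]
    simp only [hπ, uniformOnPoints, Measure.finsetSum_apply, Measure.smul_apply, smul_eq_mul,
      Measure.dirac_apply' _ hs, Measure.dirac_apply' _ (measurable_snd hs), Finset.mul_sum]
    rw [Finset.sum_comm]
    refine Finset.sum_congr rfl fun k hk => ?_
    rw [← hcard, ← hp₂ k hk, ENNReal.ofReal_sum_of_nonneg fun i _ => hp i k, Finset.sum_mul]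
    rfl
  have : IsProbabilityMeasure (π.map Prod.fst) :=
    h₁ ▸ isProbabilityMeasure_uniformOnPoints hS a
  have : IsProbabilityMeasure π :=
    Measure.isProbabilityMeasure_of_map Prod.fst
  refine (W2sq_le_of_coupling π h₁ h₂).trans_eq ?_
  have hdirac : ∀ i k, Integrable (fun z : E × E => ‖z.1 - z.2‖ ^ 2)
      (ENNReal.ofReal (p i k) • Measure.dirac (a i, b k)) := fun i k =>
    (integrable_dirac (by simp)).smul_measure ENNReal.ofReal_ne_top
  rw [hπ, integral_finsetSum_measure fun i _ =>
    integrable_finsetSum_measure.2 fun k _ => hdirac i k]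
  refine Finset.sum_congr rfl fun i _ => ?_
  rw [integral_finsetSum_measure fun k _ => hdirac i k]
  refine Finset.sum_congr rfl fun k _ => ?_
  rw [integral_smul_measure, integral_dirac, ENNReal.toReal_ofReal (hp i k), smul_eq_mul]

lemma W2sq_uniformOnPoints_le_add [NormedAddCommGroup E] [MeasurableSingletonClass E]
    {S : Finset ι} (hS : S.Nonempty) (a b a' b' : ι → E) {C : ℝ}
    (hC : ∀ i ∈ S, ∀ k ∈ S, ‖a' i - b' k‖ ^ 2 ≤ ‖a i - b k‖ ^ 2 + C) :
    W2sq (uniformOnPoints S a') (uniformOnPoints S b') ≤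
      W2sq (uniformOnPoints S a) (uniformOnPoints S b) + C := by
  have := isProbabilityMeasure_uniformOnPoints hS a
  have := isProbabilityMeasure_uniformOnPoints hS b
  rw [← sub_le_iff_le_add]
  refine le_csInf ⟨_, (uniformOnPoints S a).prod (uniformOnPoints S b), inferInstance,
    by simp [Measure.map_fst_prod], by simp [Measure.map_snd_prod], rfl⟩ ?_
  rintro r ⟨π, _, h₁, h₂, rfl⟩
  obtain ⟨p, hp, hp₁, hp₂, hcost⟩ := exists_transportPlan_of_coupling a b π h₁ h₂
  rw [hcost, sub_le_iff_le_add]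
  have hmass : ∑ i ∈ S, ∑ k ∈ S, p i k * C = C := by
    have hne : (S.card : ℝ) ≠ 0 := by simpa using hS.ne_empty
    simp only [← Finset.sum_mul, Finset.sum_congr rfl hp₁, Finset.sum_const, nsmul_eq_mul,
      mul_inv_cancel₀ hne, one_mul]
  refine (W2sq_uniformOnPoints_le hS a' b' hp hp₁ hp₂).trans ?_
  rw [← hmass]
  simp only [← Finset.sum_add_distrib, ← mul_add]
  exact Finset.sum_le_sum fun i hi => Finset.sum_le_sum fun k hk =>
    mul_le_mul_of_nonneg_left (hC i hi k hk) (hp i k)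

end Couplings

/-- The left Riemann sum of a Lipschitz function has error at most `K * T * Δt`. -/
lemma abs_riemannSum_sub_integral_le {g : ℝ → ℝ} {K T : ℝ} (hK : 0 ≤ K)
    (hg : ∀ x ∈ Icc 0 T, ∀ y ∈ Icc 0 T, |g x - g y| ≤ K * |x - y|)
    (hcont : ContinuousOn g (Icc 0 T)) (n : ℕ) (t : ℕ → ℝ) (h0 : t 0 = 0) (hn : t n = T)
    (hlt : ∀ i < n, t i < t (i + 1)) {Δt : ℝ} (hΔ : ∀ i < n, t (i + 1) - t i ≤ Δt) :
    |(∑ i ∈ Finset.range n, g (t i) * (t (i + 1) - t i)) - ∫ s in (0 : ℝ)..T, g s| ≤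
      K * T * Δt := by
  have hmono : ∀ i j, i ≤ j → j ≤ n → t i ≤ t j := by
    intro i j hij
    induction j, hij using Nat.le_induction with
    | base => exact fun _ => le_rfl
    | succ j _ ih => exact fun hj => (ih (by omega)).trans (hlt j (by omega)).le
  have hsub : ∀ i < n, Icc (t i) (t (i + 1)) ⊆ Icc 0 T := fun i hi =>
    Icc_subset_Icc (h0 ▸ hmono 0 i (by omega) (by omega)) (hn ▸ hmono (i + 1) n (by omega) le_rfl)
  have hii : ∀ i < n, IntervalIntegrable g volume (t i) (t (i + 1)) := fun i hi =>
    (hcont.mono (by rw [uIcc_of_le (hlt i hi).le]; exact hsub i hi)).intervalIntegrable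
  rw [← h0, ← hn, ← intervalIntegral.sum_integral_adjacent_intervals hii,
    ← Finset.sum_sub_distrib]
  refine (Finset.abs_sum_le_sum_abs _ _).trans ?_
  have hterm : ∀ i ∈ Finset.range n,
      |g (t i) * (t (i + 1) - t i) - ∫ s in (t i)..(t (i + 1)), g s| ≤
        K * Δt * (t (i + 1) - t i) := by
    intro i hi
    have hi := Finset.mem_range.1 hi
    have hle := (hlt i hi).le
    have hconst : g (t i) * (t (i + 1) - t i) = ∫ _ in (t i)..(t (i + 1)), g (t i) := by
      rw [intervalIntegral.integral_const, smul_eq_mul, mul_comm]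
    rw [hconst, ← intervalIntegral.integral_sub intervalIntegrable_const (hii i hi),
      ← Real.norm_eq_abs]
    refine (intervalIntegral.norm_integral_le_of_norm_le_const (C := K * Δt)
      fun s hs => ?_).trans_eq (by rw [abs_of_nonneg (sub_nonneg.2 hle)])
    rw [uIoc_of_le hle] at hs
    refine (hg _ (hsub i hi (left_mem_Icc.2 hle)) _ (hsub i hi (Ioc_subset_Icc_self hs))).trans ?_
    refine mul_le_mul_of_nonneg_left ?_ hK
    rw [abs_sub_comm, abs_of_pos (sub_pos.2 hs.1)]
    linarith [hΔ i hi, hs.2]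
  refine (Finset.sum_le_sum hterm).trans_eq ?_
  rw [← Finset.mul_sum, Finset.sum_range_sub, h0, hn]
  ring

/-- A trajectory whose velocity has components bounded by `M` is `√d * M`-Lipschitz. -/
lemma norm_sub_le_of_hasDerivWithinAt_components_le {d : ℕ} {T M : ℝ} (hM : 0 ≤ M)
    {x v : ℝ → EuclideanSpace ℝ (Fin d)} (hv : ∀ t ∈ Icc 0 T, ∀ i, |v t i| ≤ M)
    (hx : ∀ t ∈ Icc 0 T, HasDerivWithinAt x (v t) (Icc 0 T) t) {s t : ℝ}
    (hs : s ∈ Icc 0 T) (ht : t ∈ Icc 0 T) :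
    ‖x t - x s‖ ≤ Real.sqrt d * M * |t - s| := by
  refine (convex_Icc 0 T).norm_image_sub_le_of_norm_hasDerivWithin_le hx (fun u hu => ?_) hs ht
  rw [EuclideanSpace.norm_eq]
  refine Real.sqrt_le_iff.2 ⟨by positivity, ?_⟩
  rw [mul_pow, Real.sq_sqrt d.cast_nonneg]
  calc ∑ i, ‖v u i‖ ^ 2 ≤ ∑ _i : Fin d, M ^ 2 :=
        Finset.sum_le_sum fun i _ => pow_le_pow_left₀ (norm_nonneg _) (hv u hu i) 2
    _ = d * M ^ 2 := by simp

lemma sq_norm_sub_le_of_norm_le {E : Type*} [NormedAddCommGroup E] {x y x' y' : E} {A B ε : ℝ}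
    (hx : ‖x‖ ≤ A) (hx' : ‖x'‖ ≤ A) (hy : ‖y‖ ≤ B) (hy' : ‖y'‖ ≤ B)
    (hxx : ‖x' - x‖ ≤ ε) (hyy : ‖y' - y‖ ≤ ε) :
    ‖x' - y'‖ ^ 2 ≤ ‖x - y‖ ^ 2 + 4 * ε * (A + B) := by
  have h : ‖x' - y'‖ ≤ ‖x - y‖ + 2 * ε := by
    calc ‖x' - y'‖ = ‖(x - y) + ((x' - x) - (y' - y))‖ := by congr 1; abel
      _ ≤ ‖x - y‖ + (‖x' - x‖ + ‖y' - y‖) :=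
        (norm_add_le _ _).trans (by gcongr; exact norm_sub_le _ _)
      _ ≤ ‖x - y‖ + 2 * ε := by linarith
  have h₁ : ‖x - y‖ ≤ A + B := (norm_sub_le _ _).trans (add_le_add hx hy)
  have h₂ : ‖x' - y'‖ ≤ A + B := (norm_sub_le _ _).trans (add_le_add hx' hy')
  have hε : 0 ≤ ε := (norm_nonneg _).trans hxx
  nlinarith [mul_le_mul_of_nonneg_right (sub_le_iff_le_add'.2 h)
      (add_nonneg (norm_nonneg (x' - y')) (norm_nonneg (x - y))),
    mul_le_mul_of_nonneg_left (add_le_add h₂ h₁) hε]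

/-- the `O(Δt)` Riemann-sum error claim for ODE models, after
Definition 2.3 and in the proof of Theorem 2.1: if the components of `f` are uniformly
bounded by `M` and the trajectories are bounded in norm by `X`, `X̂`, then the empirical
local squared `W₂` distance `W` is continuous on `[0,T]` and every Riemann sum of `W`
differs from `∫₀ᵀ W` by at most `4 √d · M (X + X̂) T · Δt`. -/
theorem empirical_local_W2_riemann_sum_error
    {d l N : ℕ} (hN : 0 < N) {T : ℝ} (hT : 0 < T)
    (f : EuclideanSpace ℝ (Fin d) → ℝ → EuclideanSpace ℝ (Fin l) → EuclideanSpace ℝ (Fin d))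
    (M : ℝ) (hM : 0 < M)
    (hf_bdd : ∀ (x : EuclideanSpace ℝ (Fin d)), ∀ t ∈ Icc (0 : ℝ) T,
      ∀ (θ : EuclideanSpace ℝ (Fin l)) (i : Fin d), |f x t θ i| ≤ M)
    (θ θhat : Fin N → EuclideanSpace ℝ (Fin l))
    (x₀ : Fin N → EuclideanSpace ℝ (Fin d))
    (X Xhat : Fin N → ℝ → EuclideanSpace ℝ (Fin d))
    (hX0 : ∀ j, X j 0 = x₀ j) (hXhat0 : ∀ j, Xhat j 0 = x₀ j)
    (hXode : ∀ j, ∀ t ∈ Icc (0 : ℝ) T,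
      HasDerivWithinAt (X j) (f (X j t) t (θ j)) (Icc 0 T) t)
    (hXhatode : ∀ j, ∀ t ∈ Icc (0 : ℝ) T,
      HasDerivWithinAt (Xhat j) (f (Xhat j t) t (θhat j)) (Icc 0 T) t)
    (Xb Xhb : ℝ)
    (hXb : ∀ j, ∀ t ∈ Icc (0 : ℝ) T, ‖X j t‖ ≤ Xb)
    (hXhb : ∀ j, ∀ t ∈ Icc (0 : ℝ) T, ‖Xhat j t‖ ≤ Xhb)
    (δ : ℝ) (hδ : 0 < δ) :
    ContinuousOn (empW x₀ X Xhat δ) (Icc 0 T) ∧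
    ∀ (n : ℕ) (t : ℕ → ℝ), t 0 = 0 → t n = T → (∀ i < n, t i < t (i + 1)) →
      ∀ Δt : ℝ, (∀ i < n, t (i + 1) - t i ≤ Δt) →
      |(∑ i ∈ Finset.range n, empW x₀ X Xhat δ (t i) * (t (i + 1) - t i)) -
          ∫ s in (0 : ℝ)..T, empW x₀ X Xhat δ s| ≤
        4 * Real.sqrt d * M * (Xb + Xhb) * T * Δt := by
  have hM0 := hM.le
  set K := 4 * Real.sqrt d * M * (Xb + Xhb) with hK
  have h0T : (0 : ℝ) ∈ Icc 0 T := left_mem_Icc.2 hT.le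
  have hK0 : 0 ≤ K := by
    have hb := (norm_nonneg _).trans (hXb ⟨0, hN⟩ 0 h0T)
    have hb' := (norm_nonneg _).trans (hXhb ⟨0, hN⟩ 0 h0T)
    positivity
  have hone : ∀ x ∈ Icc (0 : ℝ) T, ∀ y ∈ Icc (0 : ℝ) T,
      empW x₀ X Xhat δ x ≤ empW x₀ X Xhat δ y + K * |x - y| := by
    intro x hx y hy
    have hj : ∀ j ∈ (Finset.univ : Finset (Fin N)),
        W2sq (empMeas x₀ X δ j x) (empMeas x₀ Xhat δ j x) ≤
          W2sq (empMeas x₀ X δ j y) (empMeas x₀ Xhat δ j y) + K * |x - y| := by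
      intro j _
      refine W2sq_uniformOnPoints_le_add ⟨j, by simp [hδ.le]⟩ _ _ _ _ fun i _ k _ => ?_
      refine (sq_norm_sub_le_of_norm_le (hXb i y hy) (hXb i x hx) (hXhb k y hy) (hXhb k x hx)
        (norm_sub_le_of_hasDerivWithinAt_components_le hM0
          (fun t ht i' => hf_bdd _ t ht _ i') (hXode i) hy hx)
        (norm_sub_le_of_hasDerivWithinAt_components_le hM0
          (fun t ht i' => hf_bdd _ t ht _ i') (hXhatode k) hy hx)).trans_eq ?_
      rw [hK]
      ring
    have hN' : (N : ℝ) ≠ 0 := by exact_mod_cast hN.ne'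
    calc empW x₀ X Xhat δ x
        ≤ (N : ℝ)⁻¹ * ∑ j : Fin N,
          (W2sq (empMeas x₀ X δ j y) (empMeas x₀ Xhat δ j y) + K * |x - y|) :=
          mul_le_mul_of_nonneg_left (Finset.sum_le_sum hj) (by positivity)
      _ = empW x₀ X Xhat δ y + K * |x - y| := by
          simp only [empW, Finset.sum_add_distrib, mul_add, Finset.sum_const, Finset.card_univ,
            Fintype.card_fin, nsmul_eq_mul]
          rw [inv_mul_cancel_left₀ hN']
  have hlip : ∀ x ∈ Icc (0 : ℝ) T, ∀ y ∈ Icc (0 : ℝ) T,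
      |empW x₀ X Xhat δ x - empW x₀ X Xhat δ y| ≤ K * |x - y| := by
    intro x hx y hy
    rw [abs_sub_le_iff]
    exact ⟨by linarith [hone x hx y hy], by rw [abs_sub_comm x y]; linarith [hone y hy x hx]⟩
  have hcont : ContinuousOn (empW x₀ X Xhat δ) (Icc 0 T) :=
    (LipschitzOnWith.of_dist_le_mul (K := ⟨K, hK0⟩) fun x hx y hy => hlip x hx y hy).continuousOn
  exact ⟨hcont, fun n t h0 hn hlt Δt hΔ =>
    abs_riemannSum_sub_integral_le hK0 hlip hcont n t h0 hn hlt hΔ⟩
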